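/- The rapid decay de Rham complex (E^{rd,•}_M, d) on M = {x_1 ≥ 0, …, x_r ≥ 0} ∩ U (U ⊆ ℝ^m convex open) is a resolution of j_! ℂ_{M°}, where j : M° ↪ M is the inclusion of the interior: its degree-0 cohomology sheaf is the extension by zero of the constant sheaf on M°, and its higher cohomology sheaves vanish. -/

import Mathlib

/-!
Statement 10: the rapid decay de Rham complex `(E^{rd,•}_M, d)` on
`M = {x_1 ≥ 0, …, x_r ≥ 0} ∩ U` (`U ⊆ ℝ^m` convex open) is a resolution of
`j_! ℂ_{M°}`: its cohomology sheaves vanish in degrees `≥ 1` (local Poincaré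
lemma with rapid decay) and its degree-`0` cohomology sheaf is the extension
by zero of the constant sheaf on the interior `M°`: a locally constant rapidly
decaying function vanishes near every boundary point, and is constant near
every interior point.

Forms are represented by their coefficients on strictly increasing
multi-indices, as in Statement 9; everything is stated germwise.
-/

attribute [local instance] Classical.propDecidable

namespace Stmt10

variable (m r : ℕ)

abbrev Pt (m : ℕ) := Fin m → ℝ

/-- strictly increasing multi-indices of length `q` in `{0, …, m-1}` -/
def MI (m q : ℕ) := {f : Fin q → Fin m // StrictMono f}

noncomputable instance (q : ℕ) : Fintype (MI m q) := Subtype.fintype _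

/-- `g(x) = x_1 ⋯ x_r` -/
def gfun (x : Pt m) : ℝ := ∏ i ∈ Finset.univ.filter (fun i : Fin m => (i : ℕ) < r), x i

/-- the closed corner region `M` -/
def Mset (U : Set (Pt m)) : Set (Pt m) :=
  {x | x ∈ U ∧ ∀ i : Fin m, (i : ℕ) < r → 0 ≤ x i}

/-- its interior part `M°` -/
def Mint (U : Set (Pt m)) : Set (Pt m) :=
  {x | x ∈ U ∧ ∀ i : Fin m, (i : ℕ) < r → 0 < x i}

/-- deletion of the `k`-th entry of a multi-index -/
def del {q : ℕ} (J : MI m (q + 1)) (k : Fin (q + 1)) : MI m q :=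
  ⟨J.1 ∘ k.succAbove, J.2.comp (Fin.strictMono_succAbove k)⟩

/-- coefficients of the exterior differential of a `q`-form, with derivatives
taken within the set `T` -/
noncomputable def dCoeff (T : Set (Pt m)) {q : ℕ} (ω : MI m q → Pt m → ℝ)
    (J : MI m (q + 1)) (x : Pt m) : ℝ :=
  ∑ k : Fin (q + 1), (-1 : ℝ) ^ (k : ℕ) *
    fderivWithin ℝ (ω (del m J k)) T x (Pi.single (J.1 k) 1)

/-- `C^∞` with rapid decay along `∂M`, on `M ∩ V` -/
def RapidDecayOn (U V : Set (Pt m)) (f : Pt m → ℝ) : Prop :=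
  ContDiffOn ℝ (⊤ : ℕ∞) f (Mset m r U ∩ V) ∧
  ∀ N : ℕ, ∃ h : Pt m → ℝ, ContDiffOn ℝ (⊤ : ℕ∞) h (Mset m r U ∩ V) ∧
    ∀ x ∈ Mset m r U ∩ V, f x = (gfun m r x) ^ N * h x

theorem eventually_forall_Icc_norm_sub_lt {E G : Type*} [TopologicalSpace E]
    [NormedAddCommGroup G] {K : Set E} {F : E → ℝ → G} {a b : ℝ}
    (hF : ContinuousOn (Function.uncurry F) (K ×ˢ Set.Icc a b)) {x : E} (hx : x ∈ K)
    {ε : ℝ} (hε : 0 < ε) :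
    ∀ᶠ y in nhdsWithin x K, ∀ t ∈ Set.Icc a b, ‖F y t - F x t‖ < ε := by
  obtain ⟨v, hv, h⟩ := isCompact_Icc.mem_uniformity_of_prod hF hx (Metric.dist_mem_uniformity hε)
  filter_upwards [hv] with y hy t ht
  simpa [dist_eq_norm] using h y hy t ht

theorem intervalIntegrable_of_continuousOn_prod {E G : Type*} [TopologicalSpace E]
    [NormedAddCommGroup G] {K : Set E} {F : E → ℝ → G}
    (hF : ContinuousOn (Function.uncurry F) (K ×ˢ Set.Icc 0 1)) {x : E} (hx : x ∈ K) :
    IntervalIntegrable (F x) MeasureTheory.volume 0 1 := by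
  apply ContinuousOn.intervalIntegrable
  rw [Set.uIcc_of_le zero_le_one]
  exact hF.comp (f := fun t => (x, t)) (by fun_prop) fun t ht => ⟨hx, ht⟩

theorem continuousOn_integral_Icc {E G : Type*} [TopologicalSpace E]
    [NormedAddCommGroup G] [NormedSpace ℝ G] {K : Set E} {F : E → ℝ → G}
    (hF : ContinuousOn (Function.uncurry F) (K ×ˢ Set.Icc 0 1)) :
    ContinuousOn (fun x => ∫ t in (0 : ℝ)..1, F x t) K := by
  intro x hx
  rw [ContinuousWithinAt, Metric.tendsto_nhds]
  intro ε hε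
  filter_upwards [eventually_forall_Icc_norm_sub_lt hF hx (half_pos hε), self_mem_nhdsWithin]
    with y hy hyK
  rw [dist_eq_norm, ← intervalIntegral.integral_sub (intervalIntegrable_of_continuousOn_prod hF hyK)
    (intervalIntegrable_of_continuousOn_prod hF hx)]
  have := intervalIntegral.norm_integral_le_of_norm_le_const (a := (0 : ℝ)) (b := 1)
    (f := fun t => F y t - F x t) (C := ε / 2) fun t ht => (hy t <| by
      rw [Set.uIoc_of_le zero_le_one] at ht
      exact Set.Ioc_subset_Icc_self ht).le
  simp only [sub_zero, abs_one, mul_one] at this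
  linarith

theorem hasFDerivWithinAt_integral_Icc {E G : Type*} [NormedAddCommGroup E] [NormedSpace ℝ E]
    [NormedAddCommGroup G] [NormedSpace ℝ G] [CompleteSpace G] {K : Set E} (hK : Convex ℝ K)
    {F : E → ℝ → G} {F' : E → ℝ → E →L[ℝ] G}
    (hF : ContinuousOn (Function.uncurry F) (K ×ˢ Set.Icc 0 1))
    (hF' : ContinuousOn (Function.uncurry F') (K ×ˢ Set.Icc 0 1))
    (hd : ∀ x ∈ K, ∀ t ∈ Set.Icc (0 : ℝ) 1, HasFDerivWithinAt (fun y => F y t) (F' x t) K x)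
    {x : E} (hx : x ∈ K) :
    HasFDerivWithinAt (fun y => ∫ t in (0 : ℝ)..1, F y t) (∫ t in (0 : ℝ)..1, F' x t) K x := by
  rw [hasFDerivWithinAt_iff_isLittleO, Asymptotics.isLittleO_iff]
  intro ε hε
  obtain ⟨δ, hδ, hball⟩ := Metric.mem_nhdsWithin_iff.1
    (eventually_forall_Icc_norm_sub_lt hF' hx hε)
  filter_upwards [self_mem_nhdsWithin, mem_nhdsWithin_of_mem_nhds (Metric.ball_mem_nhds x hδ)]
    with y hyK hyb
  have hi := intervalIntegrable_of_continuousOn_prod hF' hx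
  have hi' : IntervalIntegrable (fun t => F' x t (y - x)) MeasureTheory.volume 0 1 :=
    intervalIntegrable_of_continuousOn_prod (F := fun x' t => F' x' t (y - x))
      (hF'.clm_apply continuousOn_const) hx
  rw [ContinuousLinearMap.intervalIntegral_apply hi,
    ← intervalIntegral.integral_sub (intervalIntegrable_of_continuousOn_prod hF hyK)
      (intervalIntegrable_of_continuousOn_prod hF hx),
    ← intervalIntegral.integral_sub ((intervalIntegrable_of_continuousOn_prod hF hyK).sub
      (intervalIntegrable_of_continuousOn_prod hF hx)) hi']
  have := intervalIntegral.norm_integral_le_of_norm_le_const (a := (0 : ℝ)) (b := 1)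
    (f := fun t => F y t - F x t - F' x t (y - x)) (C := ε * ‖y - x‖) fun t ht => by
      have ht' : t ∈ Set.Icc (0 : ℝ) 1 := by
        rw [Set.uIoc_of_le zero_le_one] at ht
        exact Set.Ioc_subset_Icc_self ht
      refine ((convex_ball x δ).inter hK).norm_image_sub_le_of_norm_hasFDerivWithin_le'
        (f := fun z => F z t) (f' := fun z => F' z t) (φ := F' x t)
        (fun z hz => (hd z hz.2 t ht').mono Set.inter_subset_right) (fun z hz => ?_)
        ⟨Metric.mem_ball_self hδ, hx⟩ ⟨hyb, hyK⟩
      exact (hball hz t ht').le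
  simpa using this

theorem contDiffOn_integral_Icc_nat {E : Type} [NormedAddCommGroup E] [NormedSpace ℝ E]
    {K : Set E} (hK : Convex ℝ K) (hKu : UniqueDiffOn ℝ K) (n : ℕ) :
    ∀ {G : Type} [NormedAddCommGroup G] [NormedSpace ℝ G] [CompleteSpace G] {F : E → ℝ → G},
    ContDiffOn ℝ n (Function.uncurry F) (K ×ˢ Set.Icc 0 1) →
    ContDiffOn ℝ n (fun x => ∫ t in (0 : ℝ)..1, F x t) K := by
  induction n with
  | zero =>
    intro G _ _ _ F hF
    exact contDiffOn_zero.2 (continuousOn_integral_Icc hF.continuousOn)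
  | succ n ih =>
    intro G _ _ _ F hF
    have hu : UniqueDiffOn ℝ (K ×ˢ Set.Icc (0 : ℝ) 1) := hKu.prod (uniqueDiffOn_Icc zero_lt_one)
    have hn : ((n + 1 : ℕ) : WithTop ℕ∞) = (n : WithTop ℕ∞) + 1 := by push_cast; rfl
    rw [hn] at hF ⊢
    set F' : E → ℝ → E →L[ℝ] G := fun x t =>
      (fderivWithin ℝ (Function.uncurry F) (K ×ˢ Set.Icc (0 : ℝ) 1) (x, t)).comp
        (ContinuousLinearMap.inl ℝ E ℝ)
    have hF' : ContDiffOn ℝ n (Function.uncurry F') (K ×ˢ Set.Icc 0 1) :=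
      (hF.fderivWithin hu le_rfl).clm_comp contDiffOn_const
    refine (contDiffOn_succ_iff_hasFDerivWithinAt_of_uniqueDiffOn hKu).2
      ⟨by simp, _, ih hF', fun x hx => hasFDerivWithinAt_integral_Icc hK hF.continuousOn
        hF'.continuousOn (fun z hz t ht => ?_) hx⟩
    have h1 := (hF.differentiableOn (by simp) (z, t) ⟨hz, ht⟩).hasFDerivWithinAt
    exact h1.comp z (f := fun y => (y, t)) (hasFDerivAt_prodMk_left z t).hasFDerivWithinAt
      fun y hy => ⟨hy, ht⟩

theorem contDiffOn_integral_Icc {E G : Type} [NormedAddCommGroup E] [NormedSpace ℝ E]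
    [NormedAddCommGroup G] [NormedSpace ℝ G] [CompleteSpace G] {K : Set E} (hK : Convex ℝ K)
    (hKu : UniqueDiffOn ℝ K) {F : E → ℝ → G}
    (hF : ContDiffOn ℝ (⊤ : ℕ∞) (Function.uncurry F) (K ×ˢ Set.Icc 0 1)) :
    ContDiffOn ℝ (⊤ : ℕ∞) (fun x => ∫ t in (0 : ℝ)..1, F x t) K :=
  contDiffOn_infty.2 fun n => contDiffOn_integral_Icc_nat hK hKu n (contDiffOn_infty.1 hF n)

/-- evaluation of the elementary form `dx_I`: the minor of `v` on the columns `I` -/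
def elemForm {q : ℕ} (I : MI m q) : Pt m [⋀^Fin q]→ₗ[ℝ] ℝ :=
  Matrix.detRowAlternating.compLinearMap (LinearMap.funLeft ℝ ℝ I.1)

/-- the tuple of standard basis vectors indexed by `J` -/
def basisTuple {q : ℕ} (J : MI m q) : Fin q → Pt m := fun a => Pi.single (J.1 a) 1

section AlternatingForms

variable {m}

theorem removeNth_basisTuple {q : ℕ} (J : MI m (q + 1)) (k : Fin (q + 1)) :
    k.removeNth (basisTuple m J) = basisTuple m (del m J k) := rfl

theorem elemForm_basisTuple {q : ℕ} (I J : MI m q) :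
    elemForm m I (basisTuple m J) = if I = J then 1 else 0 := by
  have hdet : elemForm m I (basisTuple m J) =
      Matrix.det (Matrix.of fun a b => (Pi.single (J.1 a) 1 : Pt m) (I.1 b)) := rfl
  rw [hdet]
  split_ifs with h
  · subst h
    convert! Matrix.det_one (n := Fin q) (R := ℝ)
    ext a b
    simp [Matrix.one_apply, Pi.single_apply, I.2.injective.eq_iff, eq_comm]
  · have : ∃ a, J.1 a ∉ Set.range I.1 := by
      by_contra! hc
      apply h
      have hsub : Finset.univ.image J.1 ⊆ Finset.univ.image I.1 := by
        intro i hi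
        obtain ⟨a, -, rfl⟩ := Finset.mem_image.1 hi
        obtain ⟨b, hb⟩ := hc a
        exact Finset.mem_image.2 ⟨b, Finset.mem_univ _, hb⟩
      have heq := Finset.eq_of_subset_of_card_le hsub (by
        rw [Finset.card_image_of_injective _ I.2.injective,
          Finset.card_image_of_injective _ J.2.injective])
      refine Subtype.ext ((I.2.range_inj J.2).1 ?_)
      simpa using congrArg (fun s : Finset (Fin m) => (s : Set (Fin m))) heq.symm
    obtain ⟨a, ha⟩ := this
    refine Matrix.det_eq_zero_of_row_eq_zero a fun b => ?_
    simp only [Matrix.of_apply]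
    exact Pi.single_eq_of_ne (fun hb => ha ⟨b, hb⟩) _

/-- the alternating form with given coefficients -/
noncomputable def formOf {q : ℕ} : (MI m q → ℝ) →ₗ[ℝ] Pt m [⋀^Fin q]→ₗ[ℝ] ℝ :=
  Fintype.linearCombination ℝ (elemForm m)

theorem formOf_apply {q : ℕ} (c : MI m q → ℝ) (v : Fin q → Pt m) :
    formOf c v = ∑ I, c I * elemForm m I v := by
  let ev : (Pt m [⋀^Fin q]→ₗ[ℝ] ℝ) →+ ℝ :=
    { toFun := fun f => f v, map_zero' := rfl, map_add' := fun _ _ => rfl }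
  exact map_sum ev (fun I => c I • elemForm m I) Finset.univ

theorem formOf_basisTuple {q : ℕ} (c : MI m q → ℝ) (J : MI m q) :
    formOf c (basisTuple m J) = c J := by
  simp [formOf_apply, elemForm_basisTuple]

theorem alternatingMap_eq_zero_of_basisTuple {q : ℕ} (f : Pt m [⋀^Fin q]→ₗ[ℝ] ℝ)
    (h : ∀ J, f (basisTuple m J) = 0) : f = 0 := by
  refine Module.Basis.ext_alternating (Pi.basisFun ℝ (Fin m)) fun v hv => ?_
  have hmono : StrictMono (v ∘ Tuple.sort v) :=
    (Tuple.monotone_sort v).strictMono_of_injective (hv.comp (Tuple.sort v).injective)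
  have h1 := h ⟨_, hmono⟩
  have h2 : basisTuple m ⟨_, hmono⟩ = (fun i => Pi.basisFun ℝ (Fin m) (v i)) ∘ Tuple.sort v := by
    funext a
    simp [basisTuple]
  rw [h2, f.map_perm] at h1
  rcases Int.units_eq_one_or (Equiv.Perm.sign (Tuple.sort v)) with hs | hs <;>
    simpa [hs] using h1

/-- the algebraic identity behind the homotopy formula `dH + Hd = id` on closed forms -/
theorem homotopy_identity {q : ℕ} (c : MI m (q + 1) → ℝ) (D : MI m (q + 1) → Pt m →L[ℝ] ℝ)
    (hD : ∀ J : MI m (q + 2), ∑ k : Fin (q + 2), (-1 : ℝ) ^ (k : ℕ) *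
      D (del m J k) (Pi.single (J.1 k) 1) = 0) (y : Pt m) (t : ℝ) (J : MI m (q + 1)) :
    ∑ k : Fin (q + 1), (-1 : ℝ) ^ (k : ℕ) *
      (t * formOf (fun I => D I (basisTuple m J k))
          (Matrix.vecCons y (basisTuple m (del m J k))) +
        formOf c (Matrix.vecCons (basisTuple m J k) (basisTuple m (del m J k)))) =
      t * D J y + (q + 1) * c J := by
  set L : Pt m →ₗ[ℝ] Pt m [⋀^Fin (q + 1)]→ₗ[ℝ] ℝ :=
    formOf ∘ₗ LinearMap.pi fun I => (D I : Pt m →ₗ[ℝ] ℝ)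
  have hLv : ∀ u, L u = formOf fun I => D I u := fun u => rfl
  have hzero : AlternatingMap.alternatizeUncurryFin L = 0 := by
    refine alternatingMap_eq_zero_of_basisTuple _ fun K => ?_
    rw [AlternatingMap.alternatizeUncurryFin_apply, ← hD K]
    refine Finset.sum_congr rfl fun k _ => ?_
    rw [removeNth_basisTuple, hLv, formOf_basisTuple]
    simp [basisTuple]
  have h1 := congrArg (fun f => f (Matrix.vecCons y (basisTuple m J))) hzero
  simp only [AlternatingMap.zero_apply] at h1
  rw [AlternatingMap.alternatizeUncurryFin_apply, Fin.sum_univ_succ] at h1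
  have h2 := congrArg (fun f => f (basisTuple m J))
    (AlternatingMap.alternatizeUncurryFin_curryLeft (formOf c))
  simp only [AlternatingMap.alternatizeUncurryFin_apply, AlternatingMap.curryLeft_apply_apply,
    removeNth_basisTuple, AlternatingMap.smul_apply, formOf_basisTuple] at h2
  have h3 : ∀ k : Fin (q + 1), k.succ.removeNth (Matrix.vecCons y (basisTuple m J)) =
      Matrix.vecCons y (basisTuple m (del m J k)) := by
    intro k
    rw [← removeNth_basisTuple]
    exact Fin.cons_comp_succ_succAbove y (basisTuple m J) k
  have h4 : ∀ k : Fin (q + 1), (-1 : ℝ) ^ (k : ℕ) *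
      formOf (fun I => D I (basisTuple m J k)) (Matrix.vecCons y (basisTuple m (del m J k))) =
      (-1 : ℝ) ^ (k : ℕ) * L (basisTuple m J k) (k.succ.removeNth
        (Matrix.vecCons y (basisTuple m J))) := fun k => by rw [h3, hLv]
  have h5 : L y (basisTuple m J) = D J y := by rw [hLv, formOf_basisTuple]
  have h6 : ∑ k : Fin (q + 1), (-1 : ℝ) ^ (k : ℕ) *
      formOf (fun I => D I (basisTuple m J k)) (Matrix.vecCons y (basisTuple m (del m J k))) =
      D J y := by
    rw [Finset.sum_congr rfl fun k _ => h4 k, ← h5]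
    have h0 : Fin.removeNth 0 (Matrix.vecCons y (basisTuple m J)) = basisTuple m J := rfl
    simp only [Fin.val_zero, pow_zero, one_smul, Matrix.cons_val_zero, h0, Matrix.cons_val_succ,
      Fin.val_succ, pow_succ, mul_neg, mul_one, neg_smul, Finset.sum_neg_distrib] at h1
    simp only [zsmul_eq_mul, Int.cast_pow, Int.cast_neg, Int.cast_one] at h1
    linarith
  have h7 : ∑ k : Fin (q + 1), (-1 : ℝ) ^ (k : ℕ) *
      formOf c (Matrix.vecCons (basisTuple m J k) (basisTuple m (del m J k))) =
      (q + 1) * c J := by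
    simpa using h2
  rw [← h6, ← h7, Finset.mul_sum, ← Finset.sum_add_distrib]
  exact Finset.sum_congr rfl fun k _ => by ring

end AlternatingForms

section Homotopy

variable {m}

/-- contraction of `dx_I` with a vector, evaluated on the basis tuple `J` -/
noncomputable def contr {q : ℕ} (I : MI m (q + 1)) (J : MI m q) : Pt m →L[ℝ] ℝ :=
  LinearMap.toContinuousLinearMap
    { toFun := fun y => elemForm m I (Matrix.vecCons y (basisTuple m J))
      map_add' := fun _ _ => AlternatingMap.map_vecCons_add _ _ _ _
      map_smul' := fun _ _ => AlternatingMap.map_vecCons_smul _ _ _ _ }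

theorem formOf_vecCons {q : ℕ} (c : MI m (q + 1) → ℝ) (y : Pt m) (J : MI m q) :
    formOf c (Matrix.vecCons y (basisTuple m J)) = ∑ I, c I * contr I J y :=
  formOf_apply _ _

/-- integrand of the radial homotopy operator, for coefficients `a I x t` along the segment
from `x₀` to `x` -/
noncomputable def radialIntegrand {q : ℕ} (x₀ : Pt m) (a : MI m (q + 1) → Pt m → ℝ → ℝ)
    (J : MI m q) (x : Pt m) (t : ℝ) : ℝ :=
  t ^ q * ∑ I, a I x t * contr I J (x - x₀)

/-- the radial homotopy operator with centre `x₀` -/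
noncomputable def radialHomotopy {q : ℕ} (x₀ : Pt m) (a : MI m (q + 1) → Pt m → ℝ → ℝ)
    (J : MI m q) (x : Pt m) : ℝ :=
  ∫ t in (0 : ℝ)..1, radialIntegrand x₀ a J x t

theorem contDiffOn_radialIntegrand {q : ℕ} {x₀ : Pt m} {a : MI m (q + 1) → Pt m → ℝ → ℝ}
    {S : Set (Pt m × ℝ)} (ha : ∀ I, ContDiffOn ℝ (⊤ : ℕ∞) (Function.uncurry (a I)) S)
    (J : MI m q) :
    ContDiffOn ℝ (⊤ : ℕ∞) (Function.uncurry (radialIntegrand x₀ a J)) S := by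
  have : Function.uncurry (radialIntegrand x₀ a J) = fun p : Pt m × ℝ =>
      p.2 ^ q * ∑ I, Function.uncurry (a I) p * contr I J (p.1 - x₀) := rfl
  rw [this]
  refine ContDiffOn.mul (by fun_prop) (ContDiffOn.sum fun I _ => (ha I).mul ?_)
  exact ContDiff.contDiffOn ((contr I J).contDiff.comp (contDiff_fst.sub contDiff_const))

theorem contDiffOn_radialHomotopy {q : ℕ} {x₀ : Pt m} {K : Set (Pt m)} (hK : Convex ℝ K)
    (hKu : UniqueDiffOn ℝ K) {a : MI m (q + 1) → Pt m → ℝ → ℝ}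
    (ha : ∀ I, ContDiffOn ℝ (⊤ : ℕ∞) (Function.uncurry (a I)) (K ×ˢ Set.Icc 0 1))
    (J : MI m q) : ContDiffOn ℝ (⊤ : ℕ∞) (radialHomotopy x₀ a J) K :=
  contDiffOn_integral_Icc hK hKu (contDiffOn_radialIntegrand ha J)

theorem radialHomotopy_eq_mul {q : ℕ} {x₀ : Pt m} {a b : MI m (q + 1) → Pt m → ℝ → ℝ}
    {x : Pt m} {c : ℝ} (h : ∀ I, ∀ t ∈ Set.Icc (0 : ℝ) 1, a I x t = c * b I x t) (J : MI m q) :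
    radialHomotopy x₀ a J x = c * radialHomotopy x₀ b J x := by
  rw [radialHomotopy, radialHomotopy, ← intervalIntegral.integral_const_mul]
  refine intervalIntegral.integral_congr fun t ht => ?_
  rw [Set.uIcc_of_le zero_le_one] at ht
  simp only [radialIntegrand, h _ t ht, Finset.mul_sum]
  exact Finset.sum_congr rfl fun I _ => by ring

theorem segment_mapsTo {x₀ : Pt m} {K : Set (Pt m)} (hK : Convex ℝ K) (hx₀ : x₀ ∈ K) :
    Set.MapsTo (fun p : Pt m × ℝ => x₀ + p.2 • (p.1 - x₀)) (K ×ˢ Set.Icc 0 1) K :=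
  fun _ hp => hK.add_smul_sub_mem hx₀ hp.1 hp.2

theorem contDiffOn_comp_segment {x₀ : Pt m} {K : Set (Pt m)} (hK : Convex ℝ K) (hx₀ : x₀ ∈ K)
    {f : Pt m → ℝ} (hf : ContDiffOn ℝ (⊤ : ℕ∞) f K) :
    ContDiffOn ℝ (⊤ : ℕ∞) (Function.uncurry fun (x : Pt m) (t : ℝ) => f (x₀ + t • (x - x₀)))
      (K ×ˢ Set.Icc 0 1) :=
  hf.comp (g := f) (f := fun p : Pt m × ℝ => x₀ + p.2 • (p.1 - x₀))
    (by fun_prop) (segment_mapsTo hK hx₀)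

theorem hasFDerivWithinAt_radialHomotopy {q : ℕ} {x₀ : Pt m} {K : Set (Pt m)}
    (hK : Convex ℝ K) (hKu : UniqueDiffOn ℝ K) (hx₀ : x₀ ∈ K) {η : MI m (q + 1) → Pt m → ℝ}
    (hη : ∀ I, ContDiffOn ℝ (⊤ : ℕ∞) (η I) K) (J : MI m q) {x : Pt m} (hx : x ∈ K) :
    ∃ F' : ℝ → Pt m →L[ℝ] ℝ, IntervalIntegrable F' MeasureTheory.volume 0 1 ∧
      HasFDerivWithinAt (radialHomotopy x₀ (fun I x t => η I (x₀ + t • (x - x₀))) J)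
        (∫ t in (0 : ℝ)..1, F' t) K x ∧
      ∀ t u, F' t u = t ^ q *
        (t * formOf (fun I => fderivWithin ℝ (η I) K (x₀ + t • (x - x₀)) u)
            (Matrix.vecCons (x - x₀) (basisTuple m J)) +
          formOf (fun I => η I (x₀ + t • (x - x₀))) (Matrix.vecCons u (basisTuple m J))) := by
  set D : MI m (q + 1) → Pt m → Pt m →L[ℝ] ℝ := fun I => fderivWithin ℝ (η I) K
  have hDc : ∀ I, ContinuousOn (D I) K := fun I =>
    (hη I).continuousOn_fderivWithin hKu (by simp)
  let F' : Pt m → ℝ → Pt m →L[ℝ] ℝ := fun x t => t ^ q • ∑ I,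
    (η I (x₀ + t • (x - x₀)) • contr I J +
      contr I J (x - x₀) • t • D I (x₀ + t • (x - x₀)))
  have hseg : ContinuousOn (fun p : Pt m × ℝ => x₀ + p.2 • (p.1 - x₀)) (K ×ˢ Set.Icc 0 1) := by
    fun_prop
  have hF' : ContinuousOn (Function.uncurry F') (K ×ˢ Set.Icc 0 1) := by
    have : Function.uncurry F' = fun p : Pt m × ℝ => p.2 ^ q • ∑ I,
      (η I (x₀ + p.2 • (p.1 - x₀)) • contr I J +
        contr I J (p.1 - x₀) • p.2 • D I (x₀ + p.2 • (p.1 - x₀))) := rfl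
    rw [this]
    refine ContinuousOn.smul (f := fun p : Pt m × ℝ => p.2 ^ q) (by fun_prop) (continuousOn_finsetSum _ fun I _ => ?_)
    have hsnd : ContinuousOn (fun p : Pt m × ℝ => p.2) (K ×ˢ Set.Icc 0 1) := by fun_prop
    have hc : ContinuousOn (fun p : Pt m × ℝ => contr I J (p.1 - x₀)) (K ×ˢ Set.Icc 0 1) := by
      fun_prop
    have h1 := (hη I).continuousOn.comp hseg (segment_mapsTo hK hx₀)
    have h2 := (hDc I).comp hseg (segment_mapsTo hK hx₀)
    exact (h1.smul continuousOn_const).add (hc.smul (hsnd.smul h2))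
  refine ⟨F' x, intervalIntegrable_of_continuousOn_prod hF' hx,
    hasFDerivWithinAt_integral_Icc hK
      (contDiffOn_radialIntegrand (fun I => contDiffOn_comp_segment hK hx₀ (hη I)) J).continuousOn
      hF' (fun z hz t ht => ?_) hx, fun t u => ?_⟩
  · have hin : HasFDerivWithinAt (fun y : Pt m => x₀ + t • (y - x₀))
        (t • ContinuousLinearMap.id ℝ (Pt m)) K z :=
      (((hasFDerivWithinAt_id z K).sub_const x₀).const_smul t).const_add x₀
    have hηd : ∀ I, HasFDerivWithinAt (fun y => η I (x₀ + t • (y - x₀)))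
        (t • D I (x₀ + t • (z - x₀))) K z := by
      intro I
      have hmem := segment_mapsTo hK hx₀ (Set.mk_mem_prod hz ht)
      have := ((hη I).differentiableOn (by simp) _ hmem).hasFDerivWithinAt.comp z hin
        fun y hy => segment_mapsTo hK hx₀ (Set.mk_mem_prod hy ht)
      convert! this using 1
      ext u
      simp [D]
    refine HasFDerivWithinAt.const_mul (HasFDerivWithinAt.fun_sum fun I _ => ?_) (t ^ q)
    exact (hηd I).mul ((contr I J).hasFDerivAt.comp_hasFDerivWithinAt z
      ((hasFDerivWithinAt_id z K).sub_const x₀))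
  · simp only [F', formOf_vecCons, smul_apply, sum_apply,
      add_apply, smul_eq_mul, Finset.mul_sum, ← Finset.sum_add_distrib]
    exact Finset.sum_congr rfl fun I _ => by ring

theorem dCoeff_radialHomotopy {q : ℕ} {x₀ : Pt m} {K P : Set (Pt m)}
    (hK : Convex ℝ K) (hKu : UniqueDiffOn ℝ K) (hx₀ : x₀ ∈ K) (hP : IsOpen P) (hPK : P ⊆ K)
    (hseg : ∀ x ∈ P, ∀ t ∈ Set.Ioc (0 : ℝ) 1, x₀ + t • (x - x₀) ∈ P)
    {η : MI m (q + 1) → Pt m → ℝ} (hη : ∀ I, ContDiffOn ℝ (⊤ : ℕ∞) (η I) K)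
    (hclosed : ∀ (J : MI m (q + 2)), ∀ x ∈ P, dCoeff m P η J x = 0)
    (J : MI m (q + 1)) {x : Pt m} (hx : x ∈ P) :
    dCoeff m P (radialHomotopy x₀ fun I x t => η I (x₀ + t • (x - x₀))) J x = η J x := by
  choose F' hF'i hF'd hF' using fun J' : MI m q =>
    hasFDerivWithinAt_radialHomotopy hK hKu hx₀ hη J' (hPK hx)
  have hfd : ∀ I, ∀ z ∈ P, HasFDerivAt (η I) (fderivWithin ℝ (η I) K z) z := fun I z hz =>
    (((hη I).differentiableOn (by simp) z (hPK hz)).hasFDerivWithinAt.mono hPK).hasFDerivAt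
      (hP.mem_nhds hz)
  have hpt : ∀ z ∈ P, ∀ J' : MI m (q + 2), ∑ k : Fin (q + 2), (-1 : ℝ) ^ (k : ℕ) *
      fderivWithin ℝ (η (del m J' k)) K z (Pi.single (J'.1 k) 1) = 0 := by
    intro z hz J'
    rw [← hclosed J' z hz]
    refine Finset.sum_congr rfl fun k _ => ?_
    rw [((hfd (del m J' k) z hz).hasFDerivWithinAt).fderivWithin (hP.uniqueDiffWithinAt hz)]
  have hline : ContinuousOn (fun t : ℝ => x₀ + t • (x - x₀)) (Set.Icc 0 1) := by fun_prop
  have hmaps : Set.MapsTo (fun t : ℝ => x₀ + t • (x - x₀)) (Set.Icc 0 1) K := fun t ht =>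
    segment_mapsTo hK hx₀ (Set.mk_mem_prod (hPK hx) ht)
  have hηc := (hη J).continuousOn.comp hline hmaps
  have hDc := ((hη J).continuousOn_fderivWithin hKu (by simp)).comp hline hmaps
  calc dCoeff m P (radialHomotopy x₀ fun I x t => η I (x₀ + t • (x - x₀))) J x
      = ∑ k : Fin (q + 1), (-1 : ℝ) ^ (k : ℕ) *
          ∫ t in (0 : ℝ)..1, F' (del m J k) t (basisTuple m J k) := by
        refine Finset.sum_congr rfl fun k _ => ?_
        rw [((hF'd (del m J k)).mono hPK).fderivWithin (hP.uniqueDiffWithinAt hx),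
          ContinuousLinearMap.intervalIntegral_apply (hF'i _)]
        rfl
    _ = ∫ t in (0 : ℝ)..1, ∑ k : Fin (q + 1), (-1 : ℝ) ^ (k : ℕ) *
          F' (del m J k) t (basisTuple m J k) := by
        rw [intervalIntegral.integral_finsetSum]
        · simp only [intervalIntegral.integral_const_mul]
        · intro k _
          let A := ContinuousLinearMap.apply ℝ ℝ (basisTuple m J k)
          have hi := hF'i (del m J k)
          have : IntervalIntegrable (fun t => A (F' (del m J k) t)) MeasureTheory.volume 0 1 :=
            ⟨A.integrable_comp hi.1, A.integrable_comp hi.2⟩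
          exact this.const_mul _
    _ = ∫ t in (0 : ℝ)..1, (t ^ (q + 1) * fderivWithin ℝ (η J) K (x₀ + t • (x - x₀)) (x - x₀) +
          (q + 1) * t ^ q * η J (x₀ + t • (x - x₀))) := by
        refine intervalIntegral.integral_congr_ae (Filter.Eventually.of_forall fun t ht => ?_)
        rw [Set.uIoc_of_le zero_le_one] at ht
        have := homotopy_identity (fun I => η I (x₀ + t • (x - x₀)))
          (fun I => fderivWithin ℝ (η I) K (x₀ + t • (x - x₀))) (hpt _ (hseg x hx t ht))
          (x - x₀) t J
        simp only [hF']
        rw [pow_succ, mul_assoc, mul_comm ((q : ℝ) + 1), mul_assoc, ← mul_add, ← this,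
          Finset.mul_sum]
        exact Finset.sum_congr rfl fun k _ => by ring
    _ = 1 ^ (q + 1) * η J (x₀ + (1 : ℝ) • (x - x₀)) -
          0 ^ (q + 1) * η J (x₀ + (0 : ℝ) • (x - x₀)) := by
        refine intervalIntegral.integral_eq_sub_of_hasDerivAt_of_le zero_le_one
          (f := fun t : ℝ => t ^ (q + 1) * η J (x₀ + t • (x - x₀)))
          (ContinuousOn.mul (by fun_prop) hηc) (fun t ht => ?_) ?_
        · have h1 : HasDerivAt (fun t : ℝ => x₀ + t • (x - x₀)) (x - x₀) t := by
            simpa using ((hasDerivAt_id t).smul_const (x - x₀)).const_add x₀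
          have h2 := (hfd J _ (hseg x hx t ⟨ht.1, ht.2.le⟩)).comp_hasDerivAt t h1
          convert! (hasDerivAt_pow (q + 1) t).mul h2 using 1
          simp only [Function.comp_apply, Nat.add_sub_cancel, Nat.cast_add, Nat.cast_one]
          ring
        · apply ContinuousOn.intervalIntegrable
          rw [Set.uIcc_of_le zero_le_one]
          exact (ContinuousOn.mul (by fun_prop) (hDc.clm_apply continuousOn_const)).add
            (ContinuousOn.mul (by fun_prop) hηc)
    _ = η J x := by simp

end Homotopy

section Region

variable {m r}

theorem Mint_subset_Mset (U : Set (Pt m)) : Mint m r U ⊆ Mset m r U :=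
  fun _ hx => ⟨hx.1, fun i hi => (hx.2 i hi).le⟩

theorem convex_Mset {U : Set (Pt m)} (hU : Convex ℝ U) : Convex ℝ (Mset m r U) := by
  intro x hx y hy a b ha hb hab
  refine ⟨hU hx.1 hy.1 ha hb hab, fun i hi => ?_⟩
  have h1 := hx.2 i hi
  have h2 := hy.2 i hi
  simp only [Pi.add_apply, Pi.smul_apply, smul_eq_mul]
  positivity

theorem segment_mem_Mint {U : Set (Pt m)} (hU : Convex ℝ U) {x₀ x : Pt m}
    (hx₀ : x₀ ∈ Mset m r U) (hx : x ∈ Mint m r U) {t : ℝ} (ht : t ∈ Set.Ioc (0 : ℝ) 1) :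
    x₀ + t • (x - x₀) ∈ Mint m r U := by
  refine ⟨hU.add_smul_sub_mem hx₀.1 hx.1 ⟨ht.1.le, ht.2⟩, fun i hi => ?_⟩
  have h1 := hx₀.2 i hi
  have h2 := mul_pos ht.1 (hx.2 i hi)
  have h3 := mul_nonneg (sub_nonneg.2 ht.2) h1
  simp only [Pi.add_apply, Pi.smul_apply, Pi.sub_apply, smul_eq_mul]
  linarith

theorem convex_Mint {U : Set (Pt m)} (hU : Convex ℝ U) : Convex ℝ (Mint m r U) := by
  rw [convex_iff_forall_pos]
  intro x hx y hy a b ha hb hab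
  obtain rfl : a = 1 - b := by linarith
  convert segment_mem_Mint hU (Mint_subset_Mset U hx) hy (t := b) ⟨hb, by linarith⟩ using 1
  module

theorem isOpen_Mint {U : Set (Pt m)} (hU : IsOpen U) : IsOpen (Mint m r U) := by
  have : Mint m r U = U ∩ ⋂ i : Fin m, {x | (i : ℕ) < r → 0 < x i} := by
    ext x
    simp [Mint]
  rw [this]
  refine hU.inter (isOpen_iInter_of_finite fun i => ?_)
  by_cases hi : (i : ℕ) < r
  · simpa [hi] using isOpen_lt continuous_const (continuous_apply i)
  · simp [hi]

theorem Mset_inter_subset_closure {U W : Set (Pt m)} (hU : IsOpen U) (hW : IsOpen W) :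
    Mset m r U ∩ W ⊆ closure (Mint m r U ∩ W) := by
  intro x hx
  have hc : Filter.Tendsto (fun s : ℝ => x + s • (1 : Pt m)) (nhdsWithin 0 (Set.Ioi 0))
      (nhds x) := by
    have : Continuous fun s : ℝ => x + s • (1 : Pt m) := by fun_prop
    simpa using (this.tendsto 0).mono_left nhdsWithin_le_nhds
  refine mem_closure_of_tendsto hc ?_
  filter_upwards [hc (hU.mem_nhds hx.1.1), hc (hW.mem_nhds hx.2), self_mem_nhdsWithin]
    with s hsU hsW hs
  refine ⟨⟨hsU, fun i hi => ?_⟩, hsW⟩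
  have h1 := hx.1.2 i hi
  have h2 : 0 < s := hs
  simp only [Pi.add_apply, Pi.smul_apply, Pi.one_apply, smul_eq_mul, mul_one]
  positivity

theorem Mint_inter_nonempty {U W : Set (Pt m)} (hU : IsOpen U) (hW : IsOpen W) {x : Pt m}
    (hx : x ∈ Mset m r U) (hxW : x ∈ W) : (Mint m r U ∩ W).Nonempty :=
  closure_nonempty_iff.1 ⟨x, Mset_inter_subset_closure hU hW ⟨hx, hxW⟩⟩

theorem uniqueDiffOn_Mset_inter {U W : Set (Pt m)} (hU : IsOpen U) (hUc : Convex ℝ U)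
    (hW : IsOpen W) (hWc : Convex ℝ W) {x : Pt m} (hx : x ∈ Mset m r U) (hxW : x ∈ W) :
    UniqueDiffOn ℝ (Mset m r U ∩ W) :=
  uniqueDiffOn_convex ((convex_Mset hUc).inter hWc) <|
    (Mint_inter_nonempty hU hW hx hxW).mono <| interior_maximal
      (Set.inter_subset_inter_left _ (Mint_subset_Mset U)) ((isOpen_Mint hU).inter hW)

/-- Quotient of `g` at the point at time `t` of the segment from `x₀` to `x` by `g x`, cleared
of the vanishing denominators. -/
noncomputable def radialRatio (r : ℕ) (x₀ x : Pt m) (t : ℝ) : ℝ :=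
  ∏ i ∈ Finset.univ.filter (fun i : Fin m => (i : ℕ) < r),
    if x₀ i = 0 then t else (x₀ i + t * (x i - x₀ i)) / x i

theorem gfun_segment {x₀ x : Pt m} (hx : ∀ i, x₀ i ≠ 0 → x i ≠ 0) (t : ℝ) :
    gfun m r (x₀ + t • (x - x₀)) = gfun m r x * radialRatio r x₀ x t := by
  rw [gfun, gfun, radialRatio, ← Finset.prod_mul_distrib]
  refine Finset.prod_congr rfl fun i _ => ?_
  simp only [Pi.add_apply, Pi.smul_apply, Pi.sub_apply, smul_eq_mul]
  split_ifs with h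
  · rw [h]; ring
  · rw [mul_div_cancel₀ _ (hx i h)]

theorem contDiffOn_radialRatio {x₀ : Pt m} {K : Set (Pt m)}
    (hK : ∀ x ∈ K, ∀ i, x₀ i ≠ 0 → x i ≠ 0) :
    ContDiffOn ℝ (⊤ : ℕ∞) (Function.uncurry (radialRatio r x₀)) (K ×ˢ Set.Icc 0 1) := by
  have : Function.uncurry (radialRatio r x₀) = fun p : Pt m × ℝ =>
    ∏ i ∈ Finset.univ.filter (fun i : Fin m => (i : ℕ) < r),
      if x₀ i = 0 then p.2 else (x₀ i + p.2 * (p.1 i - x₀ i)) / p.1 i := rfl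
  rw [this]
  refine contDiffOn_prod fun i _ => ?_
  split_ifs with h
  · fun_prop
  · exact ContDiffOn.div (by fun_prop) (by fun_prop) fun p hp => hK p.1 hp.1 i h

theorem RapidDecayOn.mono {U V W : Set (Pt m)} {f : Pt m → ℝ} (hf : RapidDecayOn m r U V f)
    (h : W ⊆ V) : RapidDecayOn m r U W f := by
  have hs : Mset m r U ∩ W ⊆ Mset m r U ∩ V := Set.inter_subset_inter_right _ h
  refine ⟨hf.1.mono hs, fun N => ?_⟩
  obtain ⟨g, hg, hfg⟩ := hf.2 N
  exact ⟨g, hg.mono hs, fun x hx => hfg x (hs hx)⟩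

theorem exists_ball_subset {V : Set (Pt m)} (hV : IsOpen V) {x₀ : Pt m} (hx₀ : x₀ ∈ V) :
    ∃ ε > 0, Metric.ball x₀ ε ⊆ V ∧ ∀ x ∈ Metric.ball x₀ ε, ∀ i, x₀ i ≠ 0 → x i ≠ 0 := by
  have h : ∀ᶠ x in nhds x₀, x ∈ V ∧ ∀ i, x₀ i ≠ 0 → x i ≠ 0 := by
    refine (hV.eventually_mem hx₀).and (Filter.eventually_all.2 fun i => ?_)
    by_cases hi : x₀ i = 0
    · simp [hi]
    · filter_upwards [(continuous_apply i).continuousAt.eventually_ne hi] with x hx _ using hx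
  obtain ⟨ε, hε, hb⟩ := Metric.eventually_nhds_iff_ball.1 h
  exact ⟨ε, hε, fun x hx => (hb x hx).1, fun x hx => (hb x hx).2⟩

theorem rapidDecayOn_radialHomotopy {U W : Set (Pt m)} (hU : IsOpen U) (hUc : Convex ℝ U)
    (hW : IsOpen W) (hWc : Convex ℝ W) {x₀ : Pt m} (hx₀ : x₀ ∈ Mset m r U) (hx₀W : x₀ ∈ W)
    (hne : ∀ x ∈ W, ∀ i, x₀ i ≠ 0 → x i ≠ 0) {q : ℕ} {η : MI m (q + 1) → Pt m → ℝ}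
    (hη : ∀ I, RapidDecayOn m r U W (η I)) (J : MI m q) :
    RapidDecayOn m r U W (radialHomotopy x₀ (fun I x t => η I (x₀ + t • (x - x₀))) J) := by
  have hK : Convex ℝ (Mset m r U ∩ W) := (convex_Mset hUc).inter hWc
  have hKu := uniqueDiffOn_Mset_inter hU hUc hW hWc hx₀ hx₀W
  refine ⟨contDiffOn_radialHomotopy hK hKu
    (fun I => contDiffOn_comp_segment hK ⟨hx₀, hx₀W⟩ (hη I).1) J, fun N => ?_⟩
  choose h hh hηh using fun I => (hη I).2 N
  refine ⟨radialHomotopy x₀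
    (fun I x t => radialRatio r x₀ x t ^ N * h I (x₀ + t • (x - x₀))) J,
    contDiffOn_radialHomotopy hK hKu (fun I => ?_) J, fun x hx =>
      radialHomotopy_eq_mul (fun I t ht => ?_) J⟩
  · exact ((contDiffOn_radialRatio fun x hx => hne x hx.2).pow N).mul
      (contDiffOn_comp_segment hK ⟨hx₀, hx₀W⟩ (hh I))
  · rw [hηh I _ (hK.add_smul_sub_mem ⟨hx₀, hx₀W⟩ hx ht), gfun_segment (hne x hx.2)]
    ring

theorem exists_const_of_fderivWithin_eq_zero {U W : Set (Pt m)} (hU : IsOpen U)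
    (hUc : Convex ℝ U) (hW : IsOpen W) (hWc : Convex ℝ W) {f : Pt m → ℝ}
    (hf : ContDiffOn ℝ (⊤ : ℕ∞) f (Mset m r U ∩ W))
    (hd : ∀ (i : Fin m), ∀ x ∈ Mint m r U ∩ W,
      fderivWithin ℝ f (Mint m r U ∩ W) x (Pi.single i 1) = 0) :
    ∃ c, ∀ x ∈ Mset m r U ∩ W, f x = c := by
  rcases (Mset m r U ∩ W).eq_empty_or_nonempty with he | ⟨x₀, hx₀, hx₀W⟩
  · simp [he]
  obtain ⟨p, hp⟩ := Mint_inter_nonempty hU hW hx₀ hx₀W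
  have hsub : Mint m r U ∩ W ⊆ Mset m r U ∩ W :=
    Set.inter_subset_inter_left _ (Mint_subset_Mset U)
  have hconst : Set.EqOn f (fun _ => f p) (Mint m r U ∩ W) := fun x hx =>
    ((convex_Mint hUc).inter hWc).is_const_of_fderivWithin_eq_zero (𝕜 := ℝ)
      ((hf.differentiableOn (by simp)).mono hsub)
      (fun z hz => ContinuousLinearMap.coe_injective <|
        (Pi.basisFun ℝ (Fin m)).ext fun i => by simpa using hd i z hz) hx hp
  exact ⟨f p, hconst.of_subset_closure hf.continuousOn continuousOn_const hsub
    (Mset_inter_subset_closure hU hW)⟩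

theorem fderivWithin_Mint_inter_eq {U W V : Set (Pt m)} (hU : IsOpen U) (hW : IsOpen W)
    (hV : IsOpen V) (hWV : W ⊆ V) (f : Pt m → ℝ) {x : Pt m} (hx : x ∈ Mint m r U ∩ W) :
    fderivWithin ℝ f (Mint m r U ∩ W) x = fderivWithin ℝ f (Mint m r U ∩ V) x := by
  rw [fderivWithin_of_isOpen ((isOpen_Mint hU).inter hW) hx,
    fderivWithin_of_isOpen ((isOpen_Mint hU).inter hV) ⟨hx.1, hWV hx.2⟩]

end Region

theorem rapid_decay_deRham_is_resolution_of_extension_by_zero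
    (hr : 1 ≤ r) (hrm : r ≤ m)
    (U : Set (Pt m)) (hUopen : IsOpen U) (hUconv : Convex ℝ U)
    (hU0 : (0 : Pt m) ∈ U) :
    -- (1) exactness in degrees `p = q+1 ≥ 1`, germwise at every point of `M`
    (∀ x₀ ∈ Mset m r U, ∀ V : Set (Pt m), IsOpen V → x₀ ∈ V →
      ∀ (q : ℕ) (η : MI m (q + 1) → Pt m → ℝ),
        (∀ I, RapidDecayOn m r U V (η I)) →
        (∀ (J : MI m (q + 2)) (x : Pt m), x ∈ Mint m r U ∩ V →
          dCoeff m (Mint m r U ∩ V) η J x = 0) →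
        ∃ V' : Set (Pt m), IsOpen V' ∧ x₀ ∈ V' ∧ V' ⊆ V ∧
          ∃ ψ : MI m q → Pt m → ℝ,
            (∀ J, RapidDecayOn m r U V' (ψ J)) ∧
            ∀ (J : MI m (q + 1)) (x : Pt m), x ∈ Mint m r U ∩ V' →
              dCoeff m (Mint m r U ∩ V') ψ J x = η J x) ∧
    -- (2) the degree-`0` cohomology sheaf is `j_! ℂ_{M°}`: a `d`-closed rapidly
    -- decaying function vanishes near boundary points of `M`, and is constant
    -- near interior points
    (∀ x₀ ∈ Mset m r U, ∀ V : Set (Pt m), IsOpen V → x₀ ∈ V →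
      ∀ f : Pt m → ℝ, RapidDecayOn m r U V f →
        (∀ (i : Fin m) (x : Pt m), x ∈ Mint m r U ∩ V →
          fderivWithin ℝ f (Mint m r U ∩ V) x (Pi.single i 1) = 0) →
        (gfun m r x₀ = 0 →
          ∃ V' : Set (Pt m), IsOpen V' ∧ x₀ ∈ V' ∧ V' ⊆ V ∧
            ∀ x ∈ Mset m r U ∩ V', f x = 0) ∧
        (x₀ ∈ Mint m r U →
          ∃ V' : Set (Pt m), IsOpen V' ∧ x₀ ∈ V' ∧ V' ⊆ V ∧
            ∃ c : ℝ, ∀ x ∈ Mset m r U ∩ V', f x = c)) := by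
  refine ⟨fun x₀ hx₀ V hV hx₀V q η hη hclosed => ?_, fun x₀ hx₀ V hV hx₀V f hf hd => ?_⟩
  · obtain ⟨ε, hε, hWV, hne⟩ := exists_ball_subset hV hx₀V
    have hx₀W := Metric.mem_ball_self (x := x₀) hε
    have hW : IsOpen (Metric.ball x₀ ε) := Metric.isOpen_ball
    have hWc : Convex ℝ (Metric.ball x₀ ε) := convex_ball x₀ ε
    have hηW := fun I => (hη I).mono hWV
    refine ⟨Metric.ball x₀ ε, hW, hx₀W, hWV,
      radialHomotopy x₀ fun I x t => η I (x₀ + t • (x - x₀)),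
      rapidDecayOn_radialHomotopy hUopen hUconv hW hWc hx₀ hx₀W hne hηW,
      fun J x hx => dCoeff_radialHomotopy ((convex_Mset hUconv).inter hWc)
        (uniqueDiffOn_Mset_inter hUopen hUconv hW hWc hx₀ hx₀W) ⟨hx₀, hx₀W⟩
        ((isOpen_Mint hUopen).inter hW) (Set.inter_subset_inter_left _ (Mint_subset_Mset U))
        (fun z hz t ht => ⟨segment_mem_Mint hUconv hx₀ hz.1 ht,
          hWc.add_smul_sub_mem hx₀W hz.2 ⟨ht.1.le, ht.2⟩⟩)
        (fun I => (hηW I).1) (fun J z hz => ?_) J hx⟩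
    rw [← hclosed J z ⟨hz.1, hWV hz.2⟩]
    simp only [dCoeff, fderivWithin_Mint_inter_eq hUopen hW hV hWV _ hz]
  · obtain ⟨ε, hε, hWV, -⟩ := exists_ball_subset hV hx₀V
    have hx₀W := Metric.mem_ball_self (x := x₀) hε
    have hW : IsOpen (Metric.ball x₀ ε) := Metric.isOpen_ball
    obtain ⟨c, hc⟩ := exists_const_of_fderivWithin_eq_zero hUopen hUconv hW (convex_ball x₀ ε)
      (hf.mono hWV).1 fun i x hx => by
        rw [fderivWithin_Mint_inter_eq hUopen hW hV hWV f hx]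
        exact hd i x ⟨hx.1, hWV hx.2⟩
    refine ⟨fun hg => ⟨_, hW, hx₀W, hWV, fun x hx => ?_⟩, fun _ => ⟨_, hW, hx₀W, hWV, c, hc⟩⟩
    obtain ⟨h, -, hh⟩ := hf.2 1
    rw [hc x hx, ← hc x₀ ⟨hx₀, hx₀W⟩, hh x₀ ⟨hx₀, hx₀V⟩, hg]
    simp

end Stmt10
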